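/- Let d ≥ 2. There exist C > 0 and ε_0 ∈ (0,1), depending only on d, such that for all 0 < ε < ε_0 and every measurable h : 𝔻 → ℝ with ‖h‖²_{L²_M} := ∫_{𝔻} h(z)² M(v) dz < ∞, the grand canonical expectation of the square of the equilibrium fluctuation field satisfies E_ε( ζ(h)² ) ≤ C · ‖h‖²_{L²_M}, where ζ(h) is the function on configurations defined on the n-particle sector by ζ(h)(Z_n) := √μ_ε ( μ_ε^{−1} ∑_{i=1}^n h(z_i) − E_ε(π(h)) ), with π(h)(Z_n) := μ_ε^{−1} ∑_{i=1}^n h(z_i), and all the expectations (which converge absolutely) are taken with respect to the grand canonical hard-sphere Gibbs measure. -/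

import Mathlib

open MeasureTheory Real
open scoped ENNReal BigOperators Classical

noncomputable section

/-- The unit `d`-dimensional torus `𝕋^d = ℝ^d/ℤ^d`, as a product of unit circles.
It carries its Haar probability measure. -/
abbrev Torus (d : ℕ) := Fin d → AddCircle (1 : ℝ)

/-- The Euclidean quotient distance on the torus `𝕋^d`. -/
noncomputable def torusDist {d : ℕ} (x y : Torus d) : ℝ :=
  Real.sqrt (∑ i, dist (x i) (y i) ^ 2)

/-- The one-particle phase space `𝔻 = 𝕋^d × ℝ^d`. -/
abbrev Phase (d : ℕ) := Torus d × EuclideanSpace ℝ (Fin d)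

/-- The standard Maxwellian `M(v) = (2π)^{−d/2} exp(−|v|²/2)`. -/
noncomputable def maxwellian (d : ℕ) (v : EuclideanSpace ℝ (Fin d)) : ℝ :=
  (2 * π) ^ (-(d : ℝ) / 2) * Real.exp (-‖v‖ ^ 2 / 2)

/-- The Boltzmann-Grad density `μ_ε = ε^{−(d−1)}`. -/
noncomputable def mu (d : ℕ) (ε : ℝ) : ℝ := ε ^ (-((d : ℤ) - 1))

/-- The hard-core exclusion: `Z_N ∈ D^ε_N` iff all mutual torus distances of the
positions exceed `ε`. -/
def HardCore (d : ℕ) (ε : ℝ) {N : ℕ} (Z : Fin N → Phase d) : Prop :=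
  ∀ i j, i ≠ j → ε < torusDist (Z i).1 (Z j).1

/-- The density `1_{D^ε_N}(Z_N) M^{⊗N}(V_N)` of the hard-sphere Gibbs weight. -/
noncomputable def hsWeight (d : ℕ) (ε : ℝ) {N : ℕ} (Z : Fin N → Phase d) : ℝ :=
  (if HardCore d ε Z then 1 else 0) * ∏ i, maxwellian d (Z i).2

/-- The grand canonical partition function
`Z^ε = 1 + ∑_{N≥1} (μ_ε^N/N!) ∫ 1_{D^ε_N} M^{⊗N} dZ_N` (the `N = 0` term of the
series equals `1`). -/
noncomputable def partitionFn (d : ℕ) (ε : ℝ) : ℝ :=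
  ∑' N : ℕ, mu d ε ^ N / N.factorial * ∫ Z : Fin N → Phase d, hsWeight d ε Z

/-- The empirical average `π(h)(Z_n) = μ_ε^{−1} ∑_{i=1}^n h(z_i)` on the `n`-particle
sector. -/
noncomputable def empAvg (d : ℕ) (ε : ℝ) (h : Phase d → ℝ) {n : ℕ}
    (Z : Fin n → Phase d) : ℝ :=
  (mu d ε)⁻¹ * ∑ i, h (Z i)

/-- The grand canonical expectation of a family of observables `F_n : 𝔻^n → ℝ`:
`E_ε(F) = (1/Z^ε) ∑_{n≥0} (μ_ε^n/n!) ∫ 1_{D^ε_n} M^{⊗n} F_n dZ_n`. -/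
noncomputable def Eexp (d : ℕ) (ε : ℝ) (F : ∀ n : ℕ, (Fin n → Phase d) → ℝ) : ℝ :=
  (partitionFn d ε)⁻¹ *
    ∑' n : ℕ, mu d ε ^ n / n.factorial * ∫ Z : Fin n → Phase d, hsWeight d ε Z * F n Z

/-- The equilibrium fluctuation field
`ζ(h)(Z_n) = √μ_ε (μ_ε^{−1} ∑_i h(z_i) − E_ε(π(h)))`. -/
noncomputable def fluct (d : ℕ) (ε : ℝ) (h : Phase d → ℝ) (n : ℕ)
    (Z : Fin n → Phase d) : ℝ :=
  Real.sqrt (mu d ε) * (empAvg d ε h Z - Eexp d ε (fun n Z => empAvg d ε h Z))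

namespace HardCoreGas

/-- Finite configurations of labelled points of `X`. -/
abbrev Config (X : Type*) := Σ n : ℕ, Fin n → X

/-- The sum of an observable over all choices of a distinguished point of a configuration; the
observable sees the point and the remaining configuration. -/
def deleteSum {X M : Type*} [AddCommMonoid M] (f : X → Config X → M) : Config X → M
  | ⟨0, _⟩ => 0
  | ⟨n + 1, Z⟩ => ∑ j : Fin (n + 1), f (Z j) ⟨n, j.removeNth Z⟩

lemma enorm_deleteSum_le {X : Type*} (f : X → Config X → ℝ) (ω : Config X) :
    ‖deleteSum f ω‖ₑ ≤ deleteSum (fun y ω => ‖f y ω‖ₑ) ω := by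
  rcases ω with ⟨_ | n, Z⟩
  · simp [deleteSum]
  · simp only [deleteSum]
    exact enorm_sum_le _ _

section Poisson

variable {X : Type*} [MeasurableSpace X]

/-- The unnormalized Poisson measure with intensity `ν`. -/
def poisson (ν : Measure X) : Measure (Config X) :=
  Measure.sum fun n : ℕ =>
    ENNReal.ofReal (1 / n.factorial) • (Measure.pi fun _ : Fin n => ν).map (Sigma.mk n)

lemma measurable_mk (n : ℕ) : Measurable (@Sigma.mk ℕ (fun m => Fin m → X) n) :=
  fun _ hs => by
    rw [Sigma.instMeasurableSpace, MeasurableSpace.measurableSet_iInf] at hs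
    exact hs n

lemma measurableEmbedding_mk (n : ℕ) :
    MeasurableEmbedding (@Sigma.mk ℕ (fun m => Fin m → X) n) where
  injective := sigma_mk_injective
  measurable := measurable_mk n
  measurableSet_image' := fun s hs => by
    rw [Sigma.instMeasurableSpace, MeasurableSpace.measurableSet_iInf]
    intro m
    change MeasurableSet
      (@Sigma.mk ℕ (fun k => Fin k → X) m ⁻¹' (@Sigma.mk ℕ (fun k => Fin k → X) n '' s))
    by_cases h : m = n
    · subst h
      rwa [Set.preimage_image_eq _ sigma_mk_injective]
    · rw [Set.preimage_image_sigmaMk_of_ne h]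
      exact MeasurableSet.empty

lemma measurable_config {M : Type*} [MeasurableSpace M] {F : Config X → M}
    (hF : ∀ n, Measurable fun Z : Fin n → X => F ⟨n, Z⟩) : Measurable F := by
  intro s hs
  rw [Sigma.instMeasurableSpace, MeasurableSpace.measurableSet_iInf]
  exact fun n => hF n hs

lemma measurable_prod_config {Y M : Type*} [MeasurableSpace Y] [MeasurableSpace M]
    {F : Y × Config X → M}
    (hF : ∀ n, Measurable fun p : Y × (Fin n → X) => F (p.1, ⟨n, p.2⟩)) : Measurable F := by
  intro s hs
  have : F ⁻¹' s = ⋃ n, Prod.map id (Sigma.mk n) ''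
      ((fun p : Y × (Fin n → X) => F (p.1, ⟨n, p.2⟩)) ⁻¹' s) := by
    ext ⟨y, n, Z⟩
    simp only [Set.mem_preimage, Set.mem_iUnion, Set.mem_image, Prod.exists, Prod.map_apply, id,
      Prod.mk.injEq]
    constructor
    · intro h
      exact ⟨n, y, Z, h, rfl, rfl⟩
    · rintro ⟨m, y', Z', h, rfl, h'⟩
      rwa [← h']
  rw [this]
  exact MeasurableSet.iUnion fun n =>
    (MeasurableEmbedding.id.prodMap (measurableEmbedding_mk n)).measurableSet_image.2 (hF n hs)

lemma lintegral_poisson (ν : Measure X) {f : Config X → ℝ≥0∞} (hf : Measurable f) :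
    ∫⁻ ω, f ω ∂poisson ν = ∑' n : ℕ, ENNReal.ofReal (1 / n.factorial) *
      ∫⁻ Z : Fin n → X, f ⟨n, Z⟩ ∂(Measure.pi fun _ => ν) := by
  rw [poisson, lintegral_sum_measure]
  congr! with n
  rw [lintegral_smul_measure, lintegral_map hf (measurable_mk n), smul_eq_mul]

lemma hasSum_integral_poisson (ν : Measure X) {f : Config X → ℝ} (hf : Integrable f (poisson ν)) :
    HasSum (fun n : ℕ => 1 / n.factorial *
      ∫ Z : Fin n → X, f ⟨n, Z⟩ ∂(Measure.pi fun _ => ν)) (∫ ω, f ω ∂poisson ν) := by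
  convert! hasSum_integral_measure hf using 2 with n
  rw [integral_smul_measure, (measurableEmbedding_mk n).integral_map, smul_eq_mul,
    ENNReal.toReal_ofReal (by positivity)]

lemma measurable_deleteSum {M : Type*} [MeasurableSpace M] [AddCommMonoid M] [MeasurableAdd₂ M]
    {f : X → Config X → M} (hf : Measurable (Function.uncurry f)) :
    Measurable (deleteSum f) := by
  refine measurable_config fun n => ?_
  cases n with
  | zero => exact measurable_const
  | succ n =>
    refine Finset.measurable_fun_sum _ fun j _ => ?_
    have h1 : Measurable fun Z : Fin (n + 1) → X => (Z j, (⟨n, j.removeNth Z⟩ : Config X)) := by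
      refine (measurable_pi_apply j).prodMk ((measurable_mk n).comp ?_)
      exact measurable_pi_lambda _ fun i => measurable_pi_apply _
    exact hf.comp h1

variable (ν : Measure X) [IsFiniteMeasure ν]

instance : SFinite (poisson ν) := by
  unfold poisson
  infer_instance

lemma lintegral_deleteSum {f : X → Config X → ℝ≥0∞} (hf : Measurable (Function.uncurry f)) :
    ∫⁻ ω, deleteSum f ω ∂poisson ν = ∫⁻ y, ∫⁻ ω, f y ω ∂poisson ν ∂ν := by
  have hn : ∀ n : ℕ, Measurable fun p : X × (Fin n → X) => f p.1 ⟨n, p.2⟩ := fun n =>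
    hf.comp (measurable_fst.prodMk ((measurable_mk n).comp measurable_snd))
  have key : ∀ n : ℕ, ∫⁻ Z : Fin (n + 1) → X, deleteSum f ⟨n + 1, Z⟩ ∂(Measure.pi fun _ => ν) =
      (n + 1) * ∫⁻ y, ∫⁻ Z : Fin n → X, f y ⟨n, Z⟩ ∂(Measure.pi fun _ => ν) ∂ν := by
    intro n
    have hj : ∀ j : Fin (n + 1),
        ∫⁻ Z : Fin (n + 1) → X, f (Z j) ⟨n, j.removeNth Z⟩ ∂(Measure.pi fun _ => ν) =
        ∫⁻ y, ∫⁻ Z : Fin n → X, f y ⟨n, Z⟩ ∂(Measure.pi fun _ => ν) ∂ν := by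
      intro j
      rw [← lintegral_prod _ (hn n).aemeasurable]
      exact (measurePreserving_piFinSuccAbove (fun _ : Fin (n + 1) => ν) j).lintegral_comp (hn n)
    simp only [deleteSum]
    rw [lintegral_finsetSum]
    · simp [hj]
    · intro j _
      exact (hn n).comp (MeasurableEquiv.piFinSuccAbove (fun _ => X) j).measurable
  rw [lintegral_poisson ν (measurable_deleteSum hf), tsum_eq_zero_add' ENNReal.summable]
  have h1 : ∀ y, ∫⁻ ω, f y ω ∂poisson ν = ∑' n : ℕ, ENNReal.ofReal (1 / n.factorial) *
      ∫⁻ Z : Fin n → X, f y ⟨n, Z⟩ ∂(Measure.pi fun _ => ν) := fun y =>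
    lintegral_poisson ν (hf.comp measurable_prodMk_left)
  simp_rw [h1]
  have hm : ∀ n : ℕ, Measurable fun y =>
      ∫⁻ Z : Fin n → X, f y ⟨n, Z⟩ ∂(Measure.pi fun _ => ν) := fun n =>
    (hn n).lintegral_prod_right'
  rw [lintegral_tsum fun n => ((hm n).const_mul _).aemeasurable]
  have h0 : ∀ Z : Fin 0 → X, deleteSum f ⟨0, Z⟩ = 0 := fun _ => rfl
  simp only [h0, lintegral_zero, mul_zero, zero_add]
  congr! with n
  rw [key, lintegral_const_mul _ (hm n), ← mul_assoc]
  congr 1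
  have : ((n : ℝ≥0∞) + 1) = ENNReal.ofReal (n + 1) := by
    rw [ENNReal.ofReal_add (by positivity) zero_le_one]
    simp
  rw [this, ← ENNReal.ofReal_mul (by positivity)]
  congr 1
  rw [Nat.factorial_succ]
  push_cast
  field_simp

lemma integrable_deleteSum {f : X → Config X → ℝ} (hm : Measurable (Function.uncurry f))
    (hf : Integrable (Function.uncurry f) (ν.prod (poisson ν))) :
    Integrable (deleteSum f) (poisson ν) := by
  refine ⟨(measurable_deleteSum hm).aestronglyMeasurable, ?_⟩
  refine lt_of_le_of_lt (lintegral_mono (enorm_deleteSum_le f)) ?_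
  rw [lintegral_deleteSum ν (f := fun y ω => ‖f y ω‖ₑ) hm.enorm]
  have := hf.2
  rwa [HasFiniteIntegral, lintegral_prod _ hm.enorm.aemeasurable] at this

lemma integral_deleteSum_of_nonneg {f : X → Config X → ℝ} (hm : Measurable (Function.uncurry f))
    (h0 : ∀ y ω, 0 ≤ f y ω) :
    ∫ ω, deleteSum f ω ∂poisson ν = ∫ p, Function.uncurry f p ∂(ν.prod (poisson ν)) := by
  have hd : ∀ ω, 0 ≤ deleteSum f ω := by
    rintro ⟨_ | n, Z⟩
    · simp [deleteSum]
    · exact Finset.sum_nonneg fun j _ => h0 _ _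
  rw [integral_eq_lintegral_of_nonneg_ae (ae_of_all _ hd)
      (measurable_deleteSum hm).aestronglyMeasurable,
    integral_eq_lintegral_of_nonneg_ae (f := Function.uncurry f)
      (ae_of_all _ fun p => h0 p.1 p.2) hm.aestronglyMeasurable,
    lintegral_prod _ hm.ennreal_ofReal.aemeasurable]
  congr 1
  have := lintegral_deleteSum ν (f := fun y ω => ENNReal.ofReal (f y ω)) hm.ennreal_ofReal
  simp only [Function.uncurry]
  rw [← this]
  congr! with ω
  rcases ω with ⟨_ | n, Z⟩
  · simp [deleteSum]
  · simp only [deleteSum]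
    rw [ENNReal.ofReal_sum_of_nonneg fun j _ => h0 _ _]

/-- The Mecke formula for the unnormalized Poisson measure. -/
lemma integral_deleteSum {f : X → Config X → ℝ} (hm : Measurable (Function.uncurry f))
    (hf : Integrable (Function.uncurry f) (ν.prod (poisson ν))) :
    ∫ ω, deleteSum f ω ∂poisson ν = ∫ y, ∫ ω, f y ω ∂poisson ν ∂ν := by
  have hp : Measurable (Function.uncurry fun y ω => max (f y ω) 0) := hm.max measurable_const
  have hq : Measurable (Function.uncurry fun y ω => max (-f y ω) 0) := hm.neg.max measurable_const
  have hpi : Integrable (Function.uncurry fun y ω => max (f y ω) 0) (ν.prod (poisson ν)) :=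
    hf.pos_part
  have hqi : Integrable (Function.uncurry fun y ω => max (-f y ω) 0) (ν.prod (poisson ν)) :=
    hf.neg_part
  have hsub : ∀ ω, deleteSum f ω =
      deleteSum (fun y ω => max (f y ω) 0) ω - deleteSum (fun y ω => max (-f y ω) 0) ω := by
    rintro ⟨_ | n, Z⟩
    · simp [deleteSum]
    · simp only [deleteSum]
      rw [← Finset.sum_sub_distrib]
      congr! with j
      exact (max_zero_sub_max_neg_zero_eq_self _).symm
  rw [integral_congr_ae (ae_of_all _ hsub),
    integral_sub (integrable_deleteSum ν hp hpi) (integrable_deleteSum ν hq hqi),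
    integral_deleteSum_of_nonneg ν hp fun _ _ => le_max_right _ _,
    integral_deleteSum_of_nonneg ν hq fun _ _ => le_max_right _ _, ← integral_sub hpi hqi,
    integral_integral hf]
  congr! with p
  exact max_zero_sub_max_neg_zero_eq_self _

lemma integrable_pow_card {b : ℝ} (hb : 0 ≤ b) :
    Integrable (fun ω : Config X => b ^ ω.1) (poisson ν) := by
  have hm : Measurable fun ω : Config X => b ^ ω.1 :=
    measurable_config fun n => measurable_const (a := b ^ n)
  refine ⟨hm.aestronglyMeasurable, ?_⟩
  rw [HasFiniteIntegral, lintegral_poisson ν hm.enorm]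
  have : ∀ n : ℕ, ENNReal.ofReal (1 / n.factorial) *
      ∫⁻ _ : Fin n → X, ‖b ^ n‖ₑ ∂(Measure.pi fun _ => ν) =
      ENNReal.ofReal ((b * ν.real Set.univ) ^ n / n.factorial) := by
    intro n
    rw [lintegral_const, Measure.pi_univ, Finset.prod_const, Finset.card_univ, Fintype.card_fin,
      Real.enorm_of_nonneg (by positivity), ← ofReal_measureReal,
      ← ENNReal.ofReal_pow (by positivity), ← ENNReal.ofReal_mul (by positivity),
      ← ENNReal.ofReal_mul (by positivity)]
    congr 1
    rw [mul_pow]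
    ring
  simp only [this]
  exact (Real.summable_pow_div_factorial _).tsum_ofReal_lt_top

end Poisson

section Gibbs

variable {X : Type*}

/-- The indicator that all pairs of distinct points of a configuration satisfy the relation `r`. -/
def compat (r : X → X → Prop) (ω : Config X) : ℝ :=
  if ∀ i j, i ≠ j → r (ω.2 i) (ω.2 j) then 1 else 0

/-- The Gibbs weight of a configuration under hard exclusion `r` with activity `g`. -/
def weight (r : X → X → Prop) (g : X → ℝ) (ω : Config X) : ℝ :=
  compat r ω * ∏ i, g (ω.2 i)

/-- The additive functional `∑ᵢ φ(xᵢ)`. -/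
def pointSum (φ : X → ℝ) (ω : Config X) : ℝ := ∑ i, φ (ω.2 i)

/-- The activity `g` restricted to the points compatible with `y`. -/
def restr (r : X → X → Prop) (g : X → ℝ) (y x : X) : ℝ := if r y x then g x else 0

lemma compat_nonneg (r : X → X → Prop) (ω : Config X) : 0 ≤ compat r ω := by
  unfold compat; split_ifs <;> norm_num

lemma compat_le_one (r : X → X → Prop) (ω : Config X) : compat r ω ≤ 1 := by
  unfold compat; split_ifs <;> norm_num

lemma compat_mul_prod_removeNth {r : X → X → Prop} (hr : ∀ x y, r x y ↔ r y x) (g : X → ℝ)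
    {n : ℕ} (Z : Fin (n + 1) → X) (j : Fin (n + 1)) :
    compat r ⟨n + 1, Z⟩ * ∏ i : Fin n, g (Z (j.succAbove i)) =
      weight r (restr r g (Z j)) ⟨n, j.removeNth Z⟩ := by
  unfold weight compat restr Fin.removeNth
  dsimp only
  by_cases h : ∀ i : Fin n, r (Z j) (Z (j.succAbove i))
  · have : (∀ i k : Fin (n + 1), i ≠ k → r (Z i) (Z k)) ↔
        ∀ i k : Fin n, i ≠ k → r (Z (j.succAbove i)) (Z (j.succAbove k)) := by
      constructor
      · intro H i k hik
        exact H _ _ fun h' => hik (Fin.succAbove_right_injective h')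
      · intro H
        rw [j.forall_iff_succAbove]
        constructor
        · rw [j.forall_iff_succAbove]
          exact ⟨fun h' => absurd rfl h', fun i _ => h i⟩
        · intro i
          rw [j.forall_iff_succAbove]
          exact ⟨fun _ => (hr _ _).1 (h i), fun k hik => H i k fun h' => hik (by rw [h'])⟩
    simp only [this, h, if_true]
  · push Not at h
    obtain ⟨i, hi⟩ := h
    rw [if_neg fun H => hi (H _ _ (Fin.succAbove_ne j i).symm), zero_mul,
      Finset.prod_eq_zero (Finset.mem_univ i) (if_neg hi), mul_zero]

lemma weight_eq_mul_removeNth {r : X → X → Prop} (hr : ∀ x y, r x y ↔ r y x) (g : X → ℝ)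
    {n : ℕ} (Z : Fin (n + 1) → X) (j : Fin (n + 1)) :
    weight r g ⟨n + 1, Z⟩ = g (Z j) * weight r (restr r g (Z j)) ⟨n, j.removeNth Z⟩ := by
  rw [← compat_mul_prod_removeNth hr, weight, Fin.prod_univ_succAbove _ j]
  ring

lemma pointSum_eq_add_removeNth (φ : X → ℝ) {n : ℕ} (Z : Fin (n + 1) → X) (j : Fin (n + 1)) :
    pointSum φ ⟨n + 1, Z⟩ = φ (Z j) + pointSum φ ⟨n, j.removeNth Z⟩ := by
  rw [pointSum, Fin.sum_univ_succAbove _ j]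
  rfl

lemma abs_weight_le {r : X → X → Prop} {g : X → ℝ} {b : ℝ} (hg : ∀ x, |g x| ≤ b) (ω : Config X) :
    |weight r g ω| ≤ b ^ ω.1 := by
  rw [weight, abs_mul, abs_of_nonneg (compat_nonneg r ω), Finset.abs_prod]
  calc compat r ω * ∏ i, |g (ω.2 i)| ≤ 1 * ∏ _i : Fin ω.1, b :=
        mul_le_mul (compat_le_one r ω) (Finset.prod_le_prod (fun _ _ => abs_nonneg _)
          fun _ _ => hg _) (Finset.prod_nonneg fun _ _ => abs_nonneg _) zero_le_one
    _ = b ^ ω.1 := by simp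

lemma abs_pointSum_le {φ : X → ℝ} {b : ℝ} (hφ : ∀ x, |φ x| ≤ b) (ω : Config X) :
    |pointSum φ ω| ≤ ω.1 * b := by
  refine (Finset.abs_sum_le_sum_abs _ _).trans ?_
  calc ∑ i, |φ (ω.2 i)| ≤ ∑ _i : Fin ω.1, b := Finset.sum_le_sum fun _ _ => hφ _
    _ = ω.1 * b := by simp

/-- The integrand produced by distinguishing a point of a configuration. -/
def insertTerm (r : X → X → Prop) (g q : X → ℝ) (c : ℝ) (φ : X → ℝ) (y : X) (ω : Config X) : ℝ :=
  q y * (weight r (restr r g y) ω * (c + φ y + pointSum φ ω))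

lemma weight_mul_eq_deleteSum (hr : ∀ x y, r x y ↔ r y x) (g ψ : X → ℝ) (c : ℝ) (φ : X → ℝ) :
    (fun ω => weight r g ω * (pointSum ψ ω * (c + pointSum φ ω))) =
      deleteSum (insertTerm r g (fun y => ψ y * g y) c φ) := by
  ext ⟨_ | n, Z⟩
  · simp [pointSum, deleteSum]
  · simp only [deleteSum, insertTerm]
    rw [pointSum, Finset.sum_mul, Finset.mul_sum]
    refine Finset.sum_congr rfl fun j _ => ?_
    rw [weight_eq_mul_removeNth hr g Z j, pointSum_eq_add_removeNth φ Z j]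
    ring

variable [MeasurableSpace X]

/-- Measurable functions with values in `[0, 1]`. -/
structure IsActivity (g : X → ℝ) : Prop where
  measurable : Measurable g
  nonneg : ∀ x, 0 ≤ g x
  le_one : ∀ x, g x ≤ 1

lemma IsActivity.abs_le_one {g : X → ℝ} (hg : IsActivity g) (x : X) : |g x| ≤ 1 := by
  rw [abs_of_nonneg (hg.nonneg x)]
  exact hg.le_one x

lemma isActivity_one : IsActivity (fun _ : X => (1 : ℝ)) :=
  ⟨measurable_const, fun _ => zero_le_one, fun _ => le_rfl⟩

variable {r : X → X → Prop} (hrm : MeasurableSet {p : X × X | r p.1 p.2})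

include hrm in
lemma measurable_restr {g : X → ℝ} (hg : Measurable g) :
    Measurable fun p : X × X => restr r g p.1 p.2 :=
  Measurable.ite hrm (hg.comp measurable_snd) measurable_const

include hrm in
lemma IsActivity.restr {g : X → ℝ} (hg : IsActivity g) (y : X) : IsActivity (restr r g y) where
  measurable := (measurable_restr hrm hg.measurable).comp measurable_prodMk_left
  nonneg x := by unfold HardCoreGas.restr; split_ifs; exacts [hg.nonneg x, le_rfl]
  le_one x := by unfold HardCoreGas.restr; split_ifs; exacts [hg.le_one x, zero_le_one]

include hrm in
lemma measurable_compat : Measurable (compat r) := by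
  refine measurable_config fun n => ?_
  unfold compat
  refine Measurable.ite ?_ measurable_const measurable_const
  simp only [Set.ofPred_forall]
  refine MeasurableSet.iInter fun i => MeasurableSet.iInter fun j => MeasurableSet.iInter fun _ => ?_
  have hij : Measurable fun Z : Fin n → X => (Z i, Z j) :=
    (measurable_pi_apply i).prodMk (measurable_pi_apply j)
  exact hij hrm

include hrm in
lemma measurable_weight_param {Y : Type*} [MeasurableSpace Y] {G : Y → X → ℝ}
    (hG : Measurable (Function.uncurry G)) :
    Measurable fun p : Y × Config X => weight r (G p.1) p.2 := by
  have h : ∀ n, Measurable fun p : Y × (Fin n → X) => ∏ i, G p.1 (p.2 i) := fun n =>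
    Finset.measurable_fun_prod Finset.univ fun i _ => hG.comp
      (measurable_fst.prodMk ((measurable_pi_apply i).comp measurable_snd))
  exact ((measurable_compat hrm).comp measurable_snd).mul (measurable_prod_config h)

include hrm in
lemma measurable_weight {g : X → ℝ} (hg : Measurable g) : Measurable (weight r g) :=
  (measurable_compat hrm).mul (measurable_config fun _ =>
    Finset.measurable_fun_prod Finset.univ fun i _ => hg.comp (measurable_pi_apply i))

lemma measurable_pointSum {φ : X → ℝ} (hφ : Measurable φ) : Measurable (pointSum φ) :=
  measurable_config fun _ =>
    Finset.measurable_fun_sum Finset.univ fun i _ => hφ.comp (measurable_pi_apply i)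

lemma weight_nonneg {g : X → ℝ} (hg : IsActivity g) (ω : Config X) : 0 ≤ weight r g ω :=
  mul_nonneg (compat_nonneg r ω) (Finset.prod_nonneg fun _ _ => hg.nonneg _)

lemma abs_weight_le_one {g : X → ℝ} (hg : IsActivity g) (ω : Config X) : |weight r g ω| ≤ 1 := by
  simpa using abs_weight_le hg.abs_le_one ω

variable (ν : Measure X)

include hrm in
lemma integrable_weight_mul {g : X → ℝ} (hg : IsActivity g) {F : Config X → ℝ}
    (hF : Integrable F (poisson ν)) : Integrable (fun ω => weight r g ω * F ω) (poisson ν) :=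
  hF.bdd_mul (measurable_weight hrm hg.measurable).aestronglyMeasurable
    (ae_of_all _ fun ω => abs_weight_le_one hg ω)

lemma memLp_mul_activity {g ψ : X → ℝ} (hg : IsActivity g) (hψ2 : MemLp ψ 2 ν) :
    MemLp (fun y => ψ y * g y) 2 ν := by
  refine hψ2.mono (hψ2.aestronglyMeasurable.mul hg.measurable.aestronglyMeasurable)
    (ae_of_all _ fun y => ?_)
  rw [norm_mul]
  exact mul_le_of_le_one_right (norm_nonneg _) (hg.abs_le_one y)

/-- The unnormalized Gibbs expectation of `c + ∑ᵢ φ(xᵢ)`. -/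
def moment (r : X → X → Prop) (g : X → ℝ) (c : ℝ) (φ : X → ℝ) : ℝ :=
  ∫ ω, weight r g ω * (c + pointSum φ ω) ∂poisson ν

/-- The partition function with activity `g`. -/
def partition (r : X → X → Prop) (g : X → ℝ) : ℝ := ∫ ω, weight r g ω ∂poisson ν

lemma moment_one_zero (g : X → ℝ) : moment ν r g 1 (fun _ => 0) = partition ν r g := by
  simp [moment, partition, pointSum]

/-- The truncated two-point function at activity one, multiplied by the partition function. -/
def truncatedPair (r : X → X → Prop) (p : X × X) : ℝ :=
  restr r (fun _ => 1) p.1 p.2 * partition ν r (restr r (restr r (fun _ => 1) p.1) p.2) -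
    partition ν r (restr r (fun _ => 1) p.1) * partition ν r (restr r (fun _ => 1) p.2) /
      partition ν r (fun _ => 1)

lemma truncatedPair_swap (hr : ∀ x y, r x y ↔ r y x) (p : X × X) :
    truncatedPair ν r p.swap = truncatedPair ν r p := by
  have h1 : restr r (restr r (fun _ => 1) p.2) p.1 = restr r (restr r (fun _ => 1) p.1) p.2 := by
    ext x
    unfold restr
    split_ifs <;> rfl
  have h2 : restr r (fun _ => 1) p.2 p.1 = restr r (fun _ => 1) p.1 p.2 := by
    unfold restr
    simp only [hr p.2 p.1]
  simp only [truncatedPair, Prod.fst_swap, Prod.snd_swap, h1, h2]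
  ring

variable [IsFiniteMeasure ν]

instance : IsFiniteMeasure (poisson ν) := by
  have := integrable_pow_card ν (zero_le_one)
  simp only [one_pow] at this
  exact (integrable_const_iff_isFiniteMeasure one_ne_zero).1 this

lemma integrable_pointSum {φ : X → ℝ} (hm : Measurable φ) (hφ : Integrable φ ν) :
    Integrable (pointSum φ) (poisson ν) := by
  have h := integrable_deleteSum ν (f := fun y _ => φ y) (hm.comp measurable_fst) (hφ.comp_fst _)
  convert h using 1
  ext ⟨_ | n, Z⟩
  · simp [pointSum, deleteSum]
  · simp [pointSum, deleteSum]

include hrm in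
lemma integrable_moment {g : X → ℝ} (hg : IsActivity g) (c : ℝ) {φ : X → ℝ} (hm : Measurable φ)
    (hφ : Integrable φ ν) :
    Integrable (fun ω => weight r g ω * (c + pointSum φ ω)) (poisson ν) :=
  integrable_weight_mul hrm ν hg ((integrable_const c).add (integrable_pointSum ν hm hφ))

include hrm in
lemma measurable_insertTerm {g q φ : X → ℝ} (hg : Measurable g) (hq : Measurable q) (c : ℝ)
    (hφ : Measurable φ) : Measurable (Function.uncurry (insertTerm r g q c φ)) :=
  (hq.comp measurable_fst).mul ((measurable_weight_param hrm (measurable_restr hrm hg)).mul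
    ((measurable_const.add (hφ.comp measurable_fst)).add
      ((measurable_pointSum hφ).comp measurable_snd)))

include hrm in
lemma integrable_insertTerm {g q φ : X → ℝ} (hg : IsActivity g) (hq : Measurable q) (c : ℝ)
    (hφ : Measurable φ) (hq2 : MemLp q 2 ν) (hφ2 : MemLp φ 2 ν) :
    Integrable (Function.uncurry (insertTerm r g q c φ)) (ν.prod (poisson ν)) := by
  have hq1 : Integrable q ν := hq2.integrable (by norm_num)
  have hφ1 : Integrable φ ν := hφ2.integrable (by norm_num)
  have h1 : Integrable (fun y => q y * (c + φ y)) ν := by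
    simp only [mul_add]
    exact (hq1.mul_const c).add (hq2.integrable_mul hφ2)
  have h2 : Integrable (fun p : X × Config X => q p.1 * (c + φ p.1) + q p.1 * pointSum φ p.2)
      (ν.prod (poisson ν)) :=
    (h1.comp_fst _).add (hq1.mul_prod (integrable_pointSum ν hφ hφ1))
  refine h2.mono (measurable_insertTerm hrm hg.measurable hq c hφ).aestronglyMeasurable
    (ae_of_all _ fun p => ?_)
  have : Function.uncurry (insertTerm r g q c φ) p =
      weight r (restr r g p.1) p.2 * (q p.1 * (c + φ p.1) + q p.1 * pointSum φ p.2) := by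
    simp only [Function.uncurry, insertTerm]
    ring
  rw [this, norm_mul]
  exact mul_le_of_le_one_left (norm_nonneg _) (abs_weight_le_one (hg.restr hrm _) _)

include hrm in
lemma integral_deleteSum_insertTerm {g q φ : X → ℝ} (hg : IsActivity g) (hq : Measurable q) (c : ℝ)
    (hφ : Measurable φ) (hq2 : MemLp q 2 ν) (hφ2 : MemLp φ 2 ν) :
    ∫ ω, deleteSum (insertTerm r g q c φ) ω ∂poisson ν =
      ∫ y, q y * moment ν r (restr r g y) (c + φ y) φ ∂ν := by
  rw [integral_deleteSum ν (measurable_insertTerm hrm hg.measurable hq c hφ)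
    (integrable_insertTerm hrm ν hg hq c hφ hq2 hφ2)]
  simp only [insertTerm, moment, integral_const_mul]

include hrm in
lemma integrable_weight_mul_pointSum_mul (hr : ∀ x y, r x y ↔ r y x) {g ψ φ : X → ℝ}
    (hg : IsActivity g) (hψ : Measurable ψ) (c : ℝ) (hφ : Measurable φ) (hψ2 : MemLp ψ 2 ν)
    (hφ2 : MemLp φ 2 ν) :
    Integrable (fun ω => weight r g ω * (pointSum ψ ω * (c + pointSum φ ω))) (poisson ν) := by
  rw [weight_mul_eq_deleteSum hr]
  exact integrable_deleteSum ν (measurable_insertTerm hrm hg.measurable (hψ.mul hg.measurable) c hφ)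
    (integrable_insertTerm hrm ν hg (hψ.mul hg.measurable) c hφ (memLp_mul_activity ν hg hψ2) hφ2)

include hrm in
/-- The Georgii–Nguyen–Zessin equation for products of additive functionals. -/
lemma integral_weight_mul_pointSum_mul (hr : ∀ x y, r x y ↔ r y x) {g ψ φ : X → ℝ}
    (hg : IsActivity g) (hψ : Measurable ψ) (c : ℝ) (hφ : Measurable φ) (hψ2 : MemLp ψ 2 ν)
    (hφ2 : MemLp φ 2 ν) :
    ∫ ω, weight r g ω * (pointSum ψ ω * (c + pointSum φ ω)) ∂poisson ν =
      ∫ y, ψ y * g y * moment ν r (restr r g y) (c + φ y) φ ∂ν := by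
  rw [weight_mul_eq_deleteSum hr]
  exact integral_deleteSum_insertTerm hrm ν hg (hψ.mul hg.measurable) c hφ
    (memLp_mul_activity ν hg hψ2) hφ2

lemma memLp_of_abs_le {φ : X → ℝ} (hφ : Measurable φ) {b : ℝ} (hb : ∀ x, |φ x| ≤ b) :
    MemLp φ 2 ν :=
  MemLp.of_bound hφ.aestronglyMeasurable b (ae_of_all _ hb)

include hrm in
lemma hasDerivAt_moment (hr : ∀ x y, r x y ↔ r y x) {g p φ : X → ℝ} (hg : Measurable g)
    (hp : Measurable p) (hp1 : ∀ x, |p x| ≤ 1) (hφ : Measurable φ) (hφ1 : ∀ x, |φ x| ≤ 1) (c s : ℝ)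
    (hs : IsActivity fun x => g x - s * p x) :
    HasDerivAt (fun t => moment ν r (fun x => g x - t * p x) c φ)
      (-∫ y, p y * moment ν r (restr r (fun x => g x - s * p x) y) (c + φ y) φ ∂ν) s := by
  set G : ℝ → X → ℝ := fun t x => g x - t * p x with hG
  have hGm : ∀ t, Measurable (G t) := fun t => hg.sub (hp.const_mul t)
  have hG2 : ∀ t ∈ Metric.ball s 1, ∀ x, |G t x| ≤ 2 := by
    intro t ht x
    have h1 : G t x = G s x - (t - s) * p x := by simp only [hG]; ring
    have h2 : |(t - s) * p x| ≤ 1 := by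
      rw [abs_mul]
      exact mul_le_one₀ (by simpa [Real.dist_eq] using ht.le) (abs_nonneg _) (hp1 x)
    have h3 := hs.abs_le_one x
    rw [h1]
    exact (abs_sub _ _).trans (by linarith)
  set F' : ℝ → Config X → ℝ := fun t ω => compat r ω *
    (∑ j, (∏ i ∈ Finset.univ.erase j, G t (ω.2 i)) * (-p (ω.2 j))) * (c + pointSum φ ω) with hF'
  have hF's : F' s = fun ω => -deleteSum (insertTerm r (G s) p c φ) ω := by
    ext ⟨_ | n, Z⟩
    · simp [hF', deleteSum]
    · simp only [hF', deleteSum, insertTerm]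
      rw [Finset.mul_sum, Finset.sum_mul, ← Finset.sum_neg_distrib]
      refine Finset.sum_congr rfl fun j _ => ?_
      rw [← compat_mul_prod_removeNth hr, pointSum_eq_add_removeNth φ Z j]
      have : ∏ i ∈ Finset.univ.erase j, G s (Z i) = ∏ i : Fin n, G s (Z (j.succAbove i)) := by
        rw [← Finset.compl_singleton, ← Fin.image_succAbove_univ,
          Finset.prod_image fun _ _ _ _ h => Fin.succAbove_right_injective h]
      rw [this]
      ring
  have hlin : ∀ ω : Config X, |c + pointSum φ ω| ≤ (|c| + 1) * 2 ^ ω.1 := by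
    intro ω
    have h1 := abs_pointSum_le hφ1 ω
    have h2 : (ω.1 : ℝ) + 1 ≤ 2 ^ ω.1 := by exact_mod_cast Nat.lt_two_pow_self
    have h3 := abs_add_le c (pointSum φ ω)
    have h4 := mul_nonneg (abs_nonneg c) (sub_nonneg.2
      (one_le_pow₀ (one_le_two (α := ℝ)) (n := ω.1)))
    nlinarith
  have hb : Integrable (fun ω : Config X => (|c| + 1) * 8 ^ ω.1) (poisson ν) :=
    (integrable_pow_card ν (by norm_num)).const_mul _
  have hmain := hasDerivAt_integral_of_dominated_loc_of_deriv_le (μ := poisson ν)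
    (F := fun t ω => weight r (G t) ω * (c + pointSum φ ω)) (F' := F') (x₀ := s)
    (bound := fun ω => (|c| + 1) * 8 ^ ω.1) (Metric.ball_mem_nhds s zero_lt_one)
    (Filter.Eventually.of_forall fun t => ((measurable_weight hrm (hGm t)).mul
      (measurable_const.add (measurable_pointSum hφ))).aestronglyMeasurable)
    (integrable_moment hrm ν hs c hφ ((memLp_of_abs_le ν hφ hφ1).integrable (by norm_num)))
    (by
      rw [hF's]
      exact (measurable_deleteSum
        (measurable_insertTerm hrm (hGm s) hp c hφ)).neg.aestronglyMeasurable)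
    (ae_of_all _ fun ω t ht => by
      have h1 : |∑ j, (∏ i ∈ Finset.univ.erase j, G t (ω.2 i)) * (-p (ω.2 j))| ≤
          2 ^ ω.1 * 2 ^ ω.1 := by
        refine (Finset.abs_sum_le_sum_abs _ _).trans ?_
        calc ∑ j, |(∏ i ∈ Finset.univ.erase j, G t (ω.2 i)) * (-p (ω.2 j))|
            ≤ ∑ _j : Fin ω.1, (2 : ℝ) ^ ω.1 := by
              refine Finset.sum_le_sum fun j _ => ?_
              rw [abs_mul, abs_neg, Finset.abs_prod]
              calc _ ≤ (∏ _i ∈ Finset.univ.erase j, (2 : ℝ)) * 1 :=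
                    mul_le_mul (Finset.prod_le_prod (fun _ _ => abs_nonneg _)
                      fun i _ => hG2 t ht _) (hp1 _) (abs_nonneg _)
                      (Finset.prod_nonneg fun _ _ => zero_le_two)
                _ ≤ 2 ^ ω.1 := by
                    rw [mul_one, Finset.prod_const]
                    exact pow_le_pow_right₀ one_le_two
                      ((Finset.card_le_univ _).trans (by simp))
          _ = ω.1 * 2 ^ ω.1 := by simp
          _ ≤ 2 ^ ω.1 * 2 ^ ω.1 := by
              gcongr
              exact_mod_cast Nat.lt_two_pow_self.le
      rw [Real.norm_eq_abs, hF']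
      simp only [abs_mul]
      rw [abs_of_nonneg (compat_nonneg r ω)]
      calc _ ≤ 1 * (2 ^ ω.1 * 2 ^ ω.1) * ((|c| + 1) * 2 ^ ω.1) := by
            gcongr
            · exact compat_le_one r ω
            · exact hlin ω
        _ = (|c| + 1) * 8 ^ ω.1 := by
            rw [show (8 : ℝ) = 2 * 2 * 2 by norm_num, mul_pow, mul_pow]
            ring)
    hb
    (ae_of_all _ fun ω t _ => by
      have h1 : ∀ j ∈ (Finset.univ : Finset (Fin ω.1)),
          HasDerivAt (fun t => G t (ω.2 j)) (-p (ω.2 j)) t := fun j _ => by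
        simpa using ((hasDerivAt_id t).mul_const (p (ω.2 j))).const_sub (g (ω.2 j))
      have h2 := HasDerivAt.fun_finsetProd h1
      simp only [smul_eq_mul] at h2
      exact (h2.const_mul (compat r ω)).mul_const (c + pointSum φ ω))
  have h2 := hmain.2
  rw [hF's, integral_neg, integral_deleteSum_insertTerm hrm ν hs hp c hφ
    (memLp_of_abs_le ν hp hp1) (memLp_of_abs_le ν hφ hφ1)] at h2
  exact h2

include hrm in
lemma integrable_weight {g : X → ℝ} (hg : IsActivity g) : Integrable (weight r g) (poisson ν) := by
  simpa using integrable_weight_mul hrm ν hg (integrable_const (1 : ℝ))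

include hrm in
lemma moment_eq {g : X → ℝ} (hg : IsActivity g) (c : ℝ) {φ : X → ℝ} (hm : Measurable φ)
    (hφ : Integrable φ ν) :
    moment ν r g c φ = c * partition ν r g + moment ν r g 0 φ := by
  rw [moment, moment, partition, ← integral_const_mul, ← integral_add
    ((integrable_weight hrm ν hg).const_mul c) (integrable_moment hrm ν hg 0 hm hφ)]
  congr! 2 with ω
  ring

include hrm in
lemma one_le_partition {g : X → ℝ} (hg : IsActivity g) : 1 ≤ partition ν r g := by
  have h := hasSum_integral_poisson ν (integrable_weight hrm ν hg)
  have h0 := h.summable.sum_le_tsum {0} fun n _ => mul_nonneg (by positivity)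
    (integral_nonneg fun Z => weight_nonneg (r := r) hg ⟨n, Z⟩)
  rw [h.tsum_eq] at h0
  refine le_trans (le_of_eq ?_) h0
  have h1 : ∀ Z : Fin 0 → X, weight r g ⟨0, Z⟩ = 1 := fun Z => by simp [weight, compat]
  simp [h1, measureReal_def]

include hrm in
lemma partition_restr_le {g : X → ℝ} (hg : IsActivity g) (y : X) :
    partition ν r (restr r g y) ≤ partition ν r g := by
  refine integral_mono (integrable_weight hrm ν (hg.restr hrm y)) (integrable_weight hrm ν hg)
    fun ω => mul_le_mul_of_nonneg_left (Finset.prod_le_prod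
      (fun i _ => (hg.restr hrm y).nonneg _) fun i _ => ?_) (compat_nonneg r ω)
  unfold restr
  split_ifs
  exacts [le_rfl, hg.nonneg _]

/-- The Gibbs expectation of the additive functional `∑ᵢ φ(xᵢ)`. -/
def mean (r : X → X → Prop) (g φ : X → ℝ) : ℝ := moment ν r g 0 φ / partition ν r g

include hrm in
lemma abs_mean_le (hr : ∀ x y, r x y ↔ r y x) {g φ : X → ℝ} (hg : IsActivity g)
    (hφ : Measurable φ) (hφ1 : ∀ x, |φ x| ≤ 1) : |mean ν r g φ| ≤ ν.real Set.univ := by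
  have hZ := one_le_partition hrm ν hg
  have h := integral_weight_mul_pointSum_mul hrm ν hr hg hφ 1 measurable_const
    (memLp_of_abs_le ν hφ hφ1) (memLp_of_abs_le (φ := fun _ => (0 : ℝ)) ν measurable_const
      (b := 0) (by simp))
  have h0 : moment ν r g 0 φ = ∫ y, φ y * g y * partition ν r (restr r g y) ∂ν := by
    simp only [add_zero, moment_one_zero] at h
    rw [← h, moment]
    simp [pointSum]
  rw [mean, abs_div, abs_of_pos (by linarith : 0 < partition ν r g), div_le_iff₀ (by linarith), h0,
    mul_comm (ν.real _), ← Real.norm_eq_abs]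
  refine norm_integral_le_of_norm_le_const (ae_of_all _ fun y => ?_)
  have hZy := one_le_partition hrm ν (hg.restr hrm y)
  rw [norm_mul, norm_mul, Real.norm_eq_abs, Real.norm_eq_abs, Real.norm_eq_abs,
    abs_of_nonneg (by linarith : 0 ≤ partition ν r (restr r g y))]
  calc _ ≤ 1 * 1 * partition ν r g := by
        gcongr
        exacts [hφ1 y, hg.abs_le_one y, partition_restr_le hrm ν hg y]
    _ = _ := by ring

include hrm in
lemma abs_mean_restr_sub_mean_le_step (hr : ∀ x y, r x y ↔ r y x) {a D : ℝ} (hD0 : 0 ≤ D)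
    (ha : ∀ y, ν.real {x | ¬ r y x} ≤ a) {φ : X → ℝ} (hφ : Measurable φ) (hφ1 : ∀ x, |φ x| ≤ 1)
    (hD : ∀ g : X → ℝ, IsActivity g → ∀ y, |mean ν r (restr r g y) φ - mean ν r g φ| ≤ D)
    {g : X → ℝ} (hg : IsActivity g) (y₀ : X) :
    |mean ν r (restr r g y₀) φ - mean ν r g φ| ≤ a * (1 + D) := by
  have hφi : Integrable φ ν := (memLp_of_abs_le ν hφ hφ1).integrable (by norm_num)
  have hB : MeasurableSet {x | ¬ r y₀ x} := (measurable_prodMk_left hrm).compl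
  set p : X → ℝ := fun x => if r y₀ x then 0 else g x with hp
  have hpm : Measurable p := Measurable.ite (measurable_prodMk_left hrm) measurable_const
    hg.measurable
  have hp1 : ∀ x, |p x| ≤ 1 := fun x => by
    simp only [hp]; split_ifs; exacts [by simp, hg.abs_le_one x]
  have hact : ∀ s ∈ Set.Icc (0 : ℝ) 1, IsActivity fun x => g x - s * p x := by
    intro s hs
    refine ⟨hg.measurable.sub (hpm.const_mul s), fun x => ?_, fun x => ?_⟩ <;>
    · have h1 := hg.nonneg x
      have h2 := hg.le_one x
      simp only [hp]
      split_ifs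
      · linarith
      · nlinarith [hs.1, hs.2]
  have hpa : ∫ x, |p x| ∂ν ≤ a := by
    refine le_trans ?_ (ha y₀)
    rw [← integral_indicator_one hB]
    refine integral_mono (MemLp.integrable (q := 2) (by norm_num) (memLp_of_abs_le ν hpm hp1)).abs
      ((integrable_const (1 : ℝ)).indicator hB) fun x => ?_
    by_cases h : r y₀ x
    · simp [hp, h]
    · simp [hp, h, hg.abs_le_one x]
  set G : ℝ → X → ℝ := fun t x => g x - t * p x with hG
  set κ : ℝ → ℝ := fun s =>
    ((-∫ y, p y * moment ν r (restr r (G s) y) (0 + φ y) φ ∂ν) * partition ν r (G s) -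
      moment ν r (G s) 0 φ * (-∫ y, p y * partition ν r (restr r (G s) y) ∂ν)) /
        partition ν r (G s) ^ 2 with hκ
  have hder : ∀ s ∈ Set.Icc (0 : ℝ) 1, HasDerivAt (fun t => mean ν r (G t) φ) (κ s) s := by
    intro s hs
    have h1 := hasDerivAt_moment hrm ν hr hg.measurable hpm hp1 hφ hφ1 0 s (hact s hs)
    have h2 := hasDerivAt_moment hrm ν hr (φ := fun _ => 0) hg.measurable hpm hp1 measurable_const
      (by simp) 1 s (hact s hs)
    simp only [add_zero, moment_one_zero] at h2
    exact h1.fun_div h2 (by have := one_le_partition hrm ν (hact s hs); positivity)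
  have hκb : ∀ s ∈ Set.Icc (0 : ℝ) 1, ‖κ s‖ ≤ a * (1 + D) := by
    intro s hs
    have hGs := hact s hs
    change IsActivity (G s) at hGs
    have hZ := one_le_partition hrm ν hGs
    have hi1 := (integrable_insertTerm hrm ν hGs hpm 0 hφ (memLp_of_abs_le ν hpm hp1)
      (memLp_of_abs_le ν hφ hφ1)).integral_prod_left
    have hi2 := (integrable_insertTerm hrm ν hGs hpm 1 (φ := fun _ => 0) measurable_const
      (memLp_of_abs_le ν hpm hp1) (memLp_of_abs_le ν measurable_const
      (b := 0) (by simp))).integral_prod_left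
    simp only [Function.uncurry, insertTerm, integral_const_mul] at hi1 hi2
    change Integrable (fun y => p y * moment ν r (restr r (G s) y) (0 + φ y) φ) ν at hi1
    change Integrable (fun y => p y * moment ν r (restr r (G s) y) (1 + 0) (fun _ => 0)) ν at hi2
    simp only [add_zero, moment_one_zero] at hi2
    have hnum : (-∫ y, p y * moment ν r (restr r (G s) y) (0 + φ y) φ ∂ν) * partition ν r (G s) -
        moment ν r (G s) 0 φ * (-∫ y, p y * partition ν r (restr r (G s) y) ∂ν) =
        ∫ y, (moment ν r (G s) 0 φ * (p y * partition ν r (restr r (G s) y)) -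
          p y * moment ν r (restr r (G s) y) (0 + φ y) φ * partition ν r (G s)) ∂ν := by
      rw [integral_sub (hi2.const_mul _) (hi1.mul_const _), integral_const_mul, integral_mul_const]
      ring
    have hpos : 0 < partition ν r (G s) := by linarith
    rw [hκ]
    dsimp only
    rw [hnum, norm_div, norm_pow, Real.norm_of_nonneg hpos.le, div_le_iff₀ (by positivity)]
    have hpi : Integrable (fun y => |p y| * (partition ν r (G s) ^ 2 * (1 + D))) ν :=
      (MemLp.integrable (q := 2) (by norm_num) (memLp_of_abs_le ν hpm hp1)).abs.mul_const _
    refine (norm_integral_le_of_norm_le hpi (ae_of_all _ fun y => ?_)).trans ?_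
    · have hGy := hGs.restr hrm y
      have hZy := one_le_partition hrm ν hGy
      have hZle := partition_restr_le hrm ν hGs y
      have hm := hD (G s) hGs y
      have e1 : moment ν r (G s) 0 φ = mean ν r (G s) φ * partition ν r (G s) := by
        rw [mean, div_mul_cancel₀ _ hpos.ne']
      have e2 : moment ν r (restr r (G s) y) 0 φ =
          mean ν r (restr r (G s) y) φ * partition ν r (restr r (G s) y) := by
        rw [mean, div_mul_cancel₀ _ (by linarith)]
      have e3 : moment ν r (G s) 0 φ * (p y * partition ν r (restr r (G s) y)) -
          p y * moment ν r (restr r (G s) y) (0 + φ y) φ * partition ν r (G s) =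
          p y * (partition ν r (G s) * partition ν r (restr r (G s) y) *
            -(φ y + (mean ν r (restr r (G s) y) φ - mean ν r (G s) φ))) := by
        rw [moment_eq hrm ν hGy (0 + φ y) hφ hφi, e1, e2]
        ring
      rw [e3, norm_mul, norm_mul, norm_mul, norm_neg, Real.norm_of_nonneg hpos.le,
        Real.norm_of_nonneg (by linarith : 0 ≤ partition ν r (restr r (G s) y)), sq,
        Real.norm_eq_abs]
      gcongr
      exact (norm_add_le _ _).trans (add_le_add (hφ1 y) hm)
    · rw [integral_mul_const]
      calc _ ≤ a * (partition ν r (G s) ^ 2 * (1 + D)) := by gcongr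
        _ = _ := by ring
  have hmv := (convex_Icc (0 : ℝ) 1).norm_image_sub_le_of_norm_hasDerivWithin_le
    (fun s hs => (hder s hs).hasDerivWithinAt) hκb (Set.left_mem_Icc.2 zero_le_one)
    (Set.right_mem_Icc.2 zero_le_one)
  have hG0 : G 0 = g := by ext x; simp [hG]
  have hG1 : G 1 = restr r g y₀ := by
    ext x
    simp only [hG, hp, restr]
    split_ifs <;> simp
  rw [hG0, hG1] at hmv
  simpa using hmv

include hrm in
lemma abs_mean_restr_sub_mean_le (hr : ∀ x y, r x y ↔ r y x) {a : ℝ} (ha1 : a < 1)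
    (ha : ∀ y, ν.real {x | ¬ r y x} ≤ a) {φ : X → ℝ} (hφ : Measurable φ) (hφ1 : ∀ x, |φ x| ≤ 1)
    {g : X → ℝ} (hg : IsActivity g) (y₀ : X) :
    |mean ν r (restr r g y₀) φ - mean ν r g φ| ≤ a / (1 - a) := by
  set S : Set ℝ := {v | ∃ g : X → ℝ, IsActivity g ∧ ∃ y,
    v = |mean ν r (restr r g y) φ - mean ν r g φ|} with hS
  have hbdd : BddAbove S := by
    refine ⟨ν.real Set.univ + ν.real Set.univ, ?_⟩
    rintro _ ⟨g, hg, y, rfl⟩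
    exact (abs_sub _ _).trans (add_le_add (abs_mean_le hrm ν hr (hg.restr hrm y) hφ hφ1)
      (abs_mean_le hrm ν hr hg hφ hφ1))
  have hmem : |mean ν r (restr r g y₀) φ - mean ν r g φ| ∈ S := ⟨g, hg, y₀, rfl⟩
  have h0 : 0 ≤ sSup S := (abs_nonneg _).trans (le_csSup hbdd hmem)
  have hstep : sSup S ≤ a * (1 + sSup S) := by
    refine csSup_le ⟨_, hmem⟩ ?_
    rintro _ ⟨g', hg', y, rfl⟩
    exact abs_mean_restr_sub_mean_le_step hrm ν hr h0 ha hφ hφ1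
      (fun g hg y => le_csSup hbdd ⟨g, hg, y, rfl⟩) hg' y
  refine (le_csSup hbdd hmem).trans ?_
  rw [le_div_iff₀ (by linarith)]
  linarith

include hrm in
lemma measurable_partition {Y : Type*} [MeasurableSpace Y] {G : Y → X → ℝ}
    (hG : Measurable (Function.uncurry G)) : Measurable fun y => partition ν r (G y) :=
  (measurable_weight_param hrm hG).stronglyMeasurable.integral_prod_right.measurable

include hrm in
lemma measurable_truncatedPair : Measurable (truncatedPair ν r) := by
  have h1 : Measurable (Function.uncurry (restr r fun _ => 1)) :=
    measurable_restr hrm measurable_const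
  have h2 : Measurable (Function.uncurry fun p : X × X =>
      restr r (restr r (fun _ => 1) p.1) p.2) := by
    refine Measurable.ite (measurableSet_preimage
      (f := fun q : (X × X) × X => (q.1.2, q.2)) (by fun_prop) hrm) ?_ measurable_const
    exact h1.comp (f := fun q : (X × X) × X => (q.1.1, q.2)) (by fun_prop)
  have h3 := measurable_partition hrm ν h1
  exact (h1.mul (measurable_partition hrm ν h2)).sub
    (((h3.comp measurable_fst).mul (h3.comp measurable_snd)).div_const _)

include hrm in
lemma abs_truncatedPair_le (p : X × X) :
    |truncatedPair ν r p| ≤ 2 * partition ν r (fun _ => 1) := by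
  have h1 := isActivity_one.restr hrm p.1
  have hZ := one_le_partition hrm ν (r := r) isActivity_one
  have hZ1 := one_le_partition hrm ν h1
  have hZ2 := one_le_partition hrm ν (isActivity_one.restr hrm p.2)
  have hZ3 := one_le_partition hrm ν (h1.restr hrm p.2)
  have hle1 := partition_restr_le hrm ν isActivity_one p.1
  have hle2 := partition_restr_le hrm ν isActivity_one p.2
  have hle3 := partition_restr_le hrm ν h1 p.2
  refine (abs_sub _ _).trans ?_
  rw [two_mul]
  refine add_le_add ?_ ?_
  · rw [abs_mul, abs_of_nonneg (by linarith : 0 ≤ partition ν r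
      (restr r (restr r (fun _ => 1) p.1) p.2))]
    calc _ ≤ 1 * partition ν r (fun _ => 1) := by
          gcongr
          exacts [h1.abs_le_one _, hle3.trans hle1]
      _ = _ := one_mul _
  · rw [abs_of_nonneg (by positivity), div_le_iff₀ (by positivity)]
    gcongr

include hrm in
lemma integrable_mul_truncatedPair {F : X × X → ℝ} (hF : Integrable F (ν.prod ν)) :
    Integrable (fun p => F p * truncatedPair ν r p) (ν.prod ν) :=
  hF.mul_bdd (c := 2 * partition ν r (fun _ => 1))
    (measurable_truncatedPair hrm ν).aestronglyMeasurable
    (ae_of_all _ fun p => abs_truncatedPair_le hrm ν p)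

include hrm in
lemma moment_eq_integral (hr : ∀ x y, r x y ↔ r y x) {g φ : X → ℝ} (hg : IsActivity g)
    (hφ : Measurable φ) (hφ2 : MemLp φ 2 ν) :
    Integrable (fun x => φ x * g x * partition ν r (restr r g x)) ν ∧
      moment ν r g 0 φ = ∫ x, φ x * g x * partition ν r (restr r g x) ∂ν := by
  have h0 : MemLp (fun _ : X => (0 : ℝ)) 2 ν :=
    memLp_of_abs_le ν measurable_const (b := 0) (by simp)
  have hi := (integrable_insertTerm hrm ν hg (hφ.mul hg.measurable) 1 measurable_const
    (memLp_mul_activity ν hg hφ2) h0).integral_prod_left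
  have h := integral_weight_mul_pointSum_mul hrm ν hr hg hφ 1 measurable_const hφ2 h0
  simp only [Function.uncurry, insertTerm, integral_const_mul] at hi
  change Integrable (fun y => φ y * g y * moment ν r (restr r g y) (1 + 0) (fun _ => 0)) ν at hi
  simp only [add_zero, moment_one_zero] at hi h
  refine ⟨hi, ?_⟩
  rw [← h, moment]
  simp [pointSum]

include hrm in
lemma integral_mul_truncatedPair (hr : ∀ x y, r x y ↔ r y x) {φ : X → ℝ}
    (hφ : Measurable φ) (hφ2 : MemLp φ 2 ν) (y : X) :
    ∫ x, φ x * truncatedPair ν r (y, x) ∂ν = moment ν r (restr r (fun _ => 1) y) 0 φ -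
      partition ν r (restr r (fun _ => 1) y) * mean ν r (fun _ => 1) φ := by
  obtain ⟨i1, e1⟩ := moment_eq_integral hrm ν hr (isActivity_one.restr hrm y) hφ hφ2
  obtain ⟨i2, e2⟩ := moment_eq_integral hrm ν hr isActivity_one hφ hφ2
  rw [mean, e1, e2, mul_div_assoc', ← integral_const_mul, ← integral_div,
    ← integral_sub i1 ((i2.const_mul _).div_const _)]
  congr! 2 with x
  simp only [truncatedPair]
  ring

include hrm in
lemma integral_abs_truncatedPair_le (hr : ∀ x y, r x y ↔ r y x) {a : ℝ} (ha1 : a < 1)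
    (ha : ∀ y, ν.real {x | ¬ r y x} ≤ a) (y : X) :
    ∫ x, |truncatedPair ν r (y, x)| ∂ν ≤ partition ν r (fun _ => 1) * (a / (1 - a)) := by
  set φ : X → ℝ := fun x => if 0 ≤ truncatedPair ν r (y, x) then 1 else -1 with hφdef
  have hu : Measurable fun x => truncatedPair ν r (y, x) :=
    (measurable_truncatedPair hrm ν).comp measurable_prodMk_left
  have hφ : Measurable φ := Measurable.ite (measurableSet_le measurable_const hu)
    measurable_const measurable_const
  have hφ1 : ∀ x, |φ x| ≤ 1 := fun x => by simp only [hφdef]; split_ifs <;> simp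
  have habs : ∀ x, |truncatedPair ν r (y, x)| = φ x * truncatedPair ν r (y, x) := by
    intro x
    simp only [hφdef]
    split_ifs with h
    · rw [abs_of_nonneg h, one_mul]
    · rw [abs_of_neg (not_le.1 h), neg_one_mul]
  have hZ := one_le_partition hrm ν (isActivity_one.restr hrm y)
  have hle := partition_restr_le hrm ν isActivity_one y
  have hD := abs_mean_restr_sub_mean_le hrm ν hr ha1 ha hφ hφ1 isActivity_one y
  have e : moment ν r (restr r (fun _ => 1) y) 0 φ =
      mean ν r (restr r (fun _ => 1) y) φ * partition ν r (restr r (fun _ => 1) y) := by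
    rw [mean, div_mul_cancel₀ _ (by linarith)]
  simp only [habs]
  rw [integral_mul_truncatedPair hrm ν hr hφ (memLp_of_abs_le ν hφ hφ1), e]
  calc _ = partition ν r (restr r (fun _ => 1) y) *
        (mean ν r (restr r (fun _ => 1) y) φ - mean ν r (fun _ => 1) φ) := by ring
    _ ≤ partition ν r (restr r (fun _ => 1) y) * (a / (1 - a)) :=
        mul_le_mul_of_nonneg_left ((le_abs_self _).trans hD) (by linarith)
    _ ≤ _ := mul_le_mul_of_nonneg_right hle ((abs_nonneg _).trans hD)

include hrm in
/-- A Schur test for the truncated two-point function. -/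
lemma integral_mul_mul_truncatedPair_le (hr : ∀ x y, r x y ↔ r y x) {a : ℝ} (ha1 : a < 1)
    (ha : ∀ y, ν.real {x | ¬ r y x} ≤ a) {h : X → ℝ} (hh2 : MemLp h 2 ν) :
    ∫ p, h p.1 * h p.2 * truncatedPair ν r p ∂(ν.prod ν) ≤
      partition ν r (fun _ => 1) * (a / (1 - a)) * ∫ x, h x ^ 2 ∂ν := by
  have hsq : Integrable (fun x => h x ^ 2) ν := hh2.integrable_sq
  have hi0 : Integrable h ν := hh2.integrable (by norm_num)
  have hi := integrable_mul_truncatedPair hrm ν (hi0.mul_prod hi0)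
  have hi1 : Integrable (fun p : X × X => h p.1 ^ 2 * |truncatedPair ν r p|) (ν.prod ν) := by
    refine (integrable_mul_truncatedPair hrm ν (hsq.comp_fst ν)).abs.congr (ae_of_all _ fun p => ?_)
    simp only [abs_mul, abs_pow, sq_abs]
  have hswap : (fun p : X × X => h p.2 ^ 2 * |truncatedPair ν r p|) =
      fun p => (fun p : X × X => h p.1 ^ 2 * |truncatedPair ν r p|) p.swap := by
    ext p
    simp only [truncatedPair_swap ν hr, Prod.fst_swap]
  have hi2 : Integrable (fun p : X × X => h p.2 ^ 2 * |truncatedPair ν r p|) (ν.prod ν) := by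
    rw [hswap]
    exact hi1.swap
  have heq : ∫ p : X × X, h p.2 ^ 2 * |truncatedPair ν r p| ∂(ν.prod ν) =
      ∫ p : X × X, h p.1 ^ 2 * |truncatedPair ν r p| ∂(ν.prod ν) := by
    rw [hswap, integral_prod_swap (fun p : X × X => h p.1 ^ 2 * |truncatedPair ν r p|)]
  calc ∫ p, h p.1 * h p.2 * truncatedPair ν r p ∂(ν.prod ν)
      ≤ ∫ p, (2⁻¹ * (h p.1 ^ 2 * |truncatedPair ν r p|) +
          2⁻¹ * (h p.2 ^ 2 * |truncatedPair ν r p|)) ∂(ν.prod ν) := by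
        refine integral_mono hi ((hi1.const_mul _).add (hi2.const_mul _)) fun p => ?_
        refine (le_abs_self _).trans ?_
        dsimp only
        rw [abs_mul, abs_mul]
        have h1 : |h p.1| * |h p.2| ≤ 2⁻¹ * (h p.1 ^ 2 + h p.2 ^ 2) := by
          rw [← sq_abs (h p.1), ← sq_abs (h p.2)]
          nlinarith [sq_nonneg (|h p.1| - |h p.2|)]
        nlinarith [mul_le_mul_of_nonneg_right h1 (abs_nonneg (truncatedPair ν r p))]
    _ = ∫ p : X × X, h p.1 ^ 2 * |truncatedPair ν r p| ∂(ν.prod ν) := by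
        rw [integral_add (hi1.const_mul _) (hi2.const_mul _), integral_const_mul,
          integral_const_mul, heq]
        ring
    _ = ∫ y, h y ^ 2 * ∫ x, |truncatedPair ν r (y, x)| ∂ν ∂ν := by
        rw [integral_prod _ hi1]
        simp only [integral_const_mul]
    _ ≤ ∫ y, partition ν r (fun _ => 1) * (a / (1 - a)) * h y ^ 2 ∂ν := by
        have hi3 := hi1.integral_prod_left
        simp only [integral_const_mul] at hi3
        refine integral_mono hi3 (hsq.const_mul _) fun y => ?_
        dsimp only
        rw [mul_comm]
        exact mul_le_mul_of_nonneg_right (integral_abs_truncatedPair_le hrm ν hr ha1 ha y)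
          (sq_nonneg _)
    _ = _ := integral_const_mul _ _

include hrm in
/-- The variance of an additive functional of a dilute hard-core gas is controlled by the variance
under the Poisson process. -/
theorem integral_weight_mul_sub_mean_sq_le (hr : ∀ x y, r x y ↔ r y x) {a : ℝ} (ha1 : a < 1)
    (ha : ∀ y, ν.real {x | ¬ r y x} ≤ a) {h : X → ℝ} (hh : Measurable h) (hh2 : MemLp h 2 ν) :
    Integrable (fun ω => weight r (fun _ => 1) ω *
        (pointSum h ω - mean ν r (fun _ => 1) h) ^ 2) (poisson ν) ∧
      ∫ ω, weight r (fun _ => 1) ω * (pointSum h ω - mean ν r (fun _ => 1) h) ^ 2 ∂poisson ν ≤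
        partition ν r (fun _ => 1) * (1 - a)⁻¹ * ∫ x, h x ^ 2 ∂ν := by
  have hone := isActivity_one (X := X)
  have hsq : Integrable (fun x => h x ^ 2) ν := hh2.integrable_sq
  have hi0 : Integrable h ν := hh2.integrable (by norm_num)
  have hZ := one_le_partition hrm ν (r := r) hone
  set Z := partition ν r (fun _ => 1) with hZdef
  set m := mean ν r (fun _ => 1) h with hm
  have hN : moment ν r (fun _ => 1) 0 h = m * Z := by
    rw [hm, mean, div_mul_cancel₀ _ (by linarith)]
  have hexp : (fun ω => weight r (fun _ => 1) ω * (pointSum h ω - m) ^ 2) = fun ω =>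
      weight r (fun _ => 1) ω * (pointSum h ω * (0 + pointSum h ω)) +
        (-2 * m * (weight r (fun _ => 1) ω * (0 + pointSum h ω)) +
          m ^ 2 * weight r (fun _ => 1) ω) := by
    ext ω
    ring
  have I1 := integrable_weight_mul_pointSum_mul hrm ν hr hone hh 0 hh hh2 hh2
  have I2 := (integrable_moment hrm ν hone 0 hh hi0).const_mul (-2 * m)
  have I3 := (integrable_weight hrm ν hone).const_mul (m ^ 2)
  have I23 : Integrable (fun ω => -2 * m * (weight r (fun _ => 1) ω * (0 + pointSum h ω)) +
      m ^ 2 * weight r (fun _ => 1) ω) (poisson ν) := I2.add I3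
  rw [hexp]
  refine ⟨I1.add I23, ?_⟩
  rw [integral_add I1 I23, integral_add I2 I3, integral_const_mul, integral_const_mul,
    integral_weight_mul_pointSum_mul hrm ν hr hone hh 0 hh hh2 hh2]
  change _ + (-2 * m * moment ν r (fun _ => 1) 0 h + m ^ 2 * Z) ≤ _
  rw [hN]
  have J1 : Integrable (fun y => h y ^ 2 * partition ν r (restr r (fun _ => 1) y)) ν := by
    refine hsq.mul_bdd (c := Z) (measurable_partition hrm ν
      (measurable_restr hrm measurable_const)).aestronglyMeasurable (ae_of_all _ fun y => ?_)
    rw [Real.norm_of_nonneg (zero_le_one.trans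
      (one_le_partition hrm ν (hone.restr hrm y)))]
    exact partition_restr_le hrm ν hone y
  obtain ⟨J2, e2⟩ := moment_eq_integral hrm ν hr hone hh hh2
  have J3i := integrable_mul_truncatedPair hrm ν (hi0.mul_prod hi0)
  have J3 := J3i.integral_prod_left
  have hsplit : ∀ y, h y * 1 * moment ν r (restr r (fun _ => 1) y) (0 + h y) h =
      h y ^ 2 * partition ν r (restr r (fun _ => 1) y) +
        (∫ x, h y * h x * truncatedPair ν r (y, x) ∂ν +
          m * (h y * 1 * partition ν r (restr r (fun _ => 1) y))) := by
    intro y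
    rw [moment_eq hrm ν (hone.restr hrm y) _ hh hi0]
    simp only [mul_assoc]
    rw [integral_const_mul, integral_mul_truncatedPair hrm ν hr hh hh2 y]
    ring
  have J23 : Integrable (fun y => ∫ x, h y * h x * truncatedPair ν r (y, x) ∂ν +
      m * (h y * 1 * partition ν r (restr r (fun _ => 1) y))) ν := J3.add (J2.const_mul m)
  simp only [hsplit]
  rw [integral_add J1 J23, integral_add J3 (J2.const_mul m),
    integral_const_mul, ← e2, hN, ← integral_prod _ J3i]
  have B1 : ∫ y, h y ^ 2 * partition ν r (restr r (fun _ => 1) y) ∂ν ≤ Z * ∫ x, h x ^ 2 ∂ν := by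
    rw [← integral_const_mul]
    refine integral_mono J1 (hsq.const_mul Z) fun y => ?_
    dsimp only
    rw [mul_comm]
    exact mul_le_mul_of_nonneg_right (partition_restr_le hrm ν hone y) (sq_nonneg _)
  have B2 := integral_mul_mul_truncatedPair_le hrm ν hr ha1 ha hh2
  have hinv : (1 - a)⁻¹ = 1 + a / (1 - a) := by
    have : 1 - a ≠ 0 := by linarith
    field_simp
    ring
  rw [hinv]
  linarith [B1, B2]

end Gibbs

lemma pi_withDensity_ofReal {ι X : Type*} [Fintype ι] [MeasurableSpace X] (μ : Measure X)
    [SigmaFinite μ] {f : X → ℝ} (hf0 : ∀ x, 0 ≤ f x) (hfi : Integrable f μ) :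
    Measure.pi (fun _ : ι => μ.withDensity fun x => ENNReal.ofReal (f x)) =
      (Measure.pi fun _ : ι => μ).withDensity fun Z => ENNReal.ofReal (∏ i, f (Z i)) := by
  have : IsFiniteMeasure (μ.withDensity fun x => ENNReal.ofReal (f x)) :=
    isFiniteMeasure_withDensity_ofReal hfi.2
  refine Measure.pi_eq fun s hs => ?_
  rw [withDensity_apply _ (MeasurableSet.univ_pi hs), Measure.restrict_pi_pi,
    ← ofReal_integral_eq_lintegral_ofReal (Integrable.fintype_prod fun i => hfi.restrict)
      (ae_of_all _ fun Z => Finset.prod_nonneg fun i _ => hf0 _),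
    integral_fintype_prod_eq_prod (fun _ => f),
    ENNReal.ofReal_prod_of_nonneg fun i _ => integral_nonneg hf0]
  refine Finset.prod_congr rfl fun i _ => ?_
  rw [withDensity_apply _ (hs i), ofReal_integral_eq_lintegral_ofReal hfi.restrict (ae_of_all _ hf0)]

end HardCoreGas

section HardSpheres

open HardCoreGas

lemma continuous_torusDist {d : ℕ} :
    Continuous fun p : Torus d × Torus d => torusDist p.1 p.2 := by
  unfold torusDist
  fun_prop

lemma torusDist_comm {d : ℕ} (x y : Torus d) : torusDist x y = torusDist y x := by
  simp only [torusDist, dist_comm]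

lemma dist_le_torusDist {d : ℕ} (x y : Torus d) (i : Fin d) : dist (x i) (y i) ≤ torusDist x y :=
  Real.le_sqrt_of_sq_le
    (Finset.single_le_sum (f := fun i => dist (x i) (y i) ^ 2) (fun _ _ => sq_nonneg _)
      (Finset.mem_univ i))

lemma mu_pos (d : ℕ) {ε : ℝ} (hε : 0 < ε) : 0 < mu d ε := zpow_pos hε _

lemma mu_mul_pow (d : ℕ) {ε : ℝ} (hε : 0 < ε) : mu d ε * ε ^ d = ε := by
  rw [mu, ← zpow_natCast, ← zpow_add₀ hε.ne']
  simp

lemma maxwellian_nonneg (d : ℕ) (v : EuclideanSpace ℝ (Fin d)) : 0 ≤ maxwellian d v := by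
  unfold maxwellian
  positivity

lemma measurable_maxwellian (d : ℕ) : Measurable (maxwellian d) := by
  unfold maxwellian
  fun_prop

lemma integral_maxwellian (d : ℕ) : ∫ v, maxwellian d v = 1 := by
  have h := GaussianFourier.integral_rexp_neg_mul_sq_norm
    (V := EuclideanSpace ℝ (Fin d)) (b := 2⁻¹) (by norm_num)
  have e : ∀ v : EuclideanSpace ℝ (Fin d), maxwellian d v =
      (2 * π) ^ (-(d : ℝ) / 2) * Real.exp (-2⁻¹ * ‖v‖ ^ 2) := fun v => by
    unfold maxwellian
    congr 2
    ring
  simp only [e]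
  rw [integral_const_mul, h, finrank_euclideanSpace_fin, div_inv_eq_mul, mul_comm π,
    ← Real.rpow_add (by positivity)]
  simp [neg_div]

lemma integrable_maxwellian (d : ℕ) : Integrable (maxwellian d) :=
  Integrable.of_integral_ne_zero (by rw [integral_maxwellian]; exact one_ne_zero)

lemma measurable_mu_mul_maxwellian (d : ℕ) (ε : ℝ) :
    Measurable fun z : Phase d => mu d ε * maxwellian d z.2 :=
  ((measurable_maxwellian d).comp measurable_snd).const_mul _

lemma integrable_mu_mul_maxwellian (d : ℕ) (ε : ℝ) :
    Integrable fun z : Phase d => mu d ε * maxwellian d z.2 :=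
  ((integrable_maxwellian d).comp_snd _).const_mul _

/-- The one-particle intensity `μ_ε M(v) dx dv`. -/
def intensity (d : ℕ) (ε : ℝ) : Measure (Phase d) :=
  volume.withDensity fun z => ENNReal.ofReal (mu d ε * maxwellian d z.2)

instance (d : ℕ) (ε : ℝ) : IsFiniteMeasure (intensity d ε) :=
  isFiniteMeasure_withDensity_ofReal (integrable_mu_mul_maxwellian d ε).2

/-- Two particles do not overlap. -/
def Apart (d : ℕ) (ε : ℝ) (p q : Phase d) : Prop := ε < torusDist p.1 q.1

lemma apart_comm (d : ℕ) (ε : ℝ) (p q : Phase d) : Apart d ε p q ↔ Apart d ε q p := by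
  rw [Apart, Apart, torusDist_comm]

lemma measurableSet_apart (d : ℕ) (ε : ℝ) :
    MeasurableSet {p : Phase d × Phase d | Apart d ε p.1 p.2} :=
  measurableSet_lt measurable_const
    (continuous_torusDist.measurable.comp (f := fun p : Phase d × Phase d => (p.1.1, p.2.1))
      (by fun_prop))

lemma volume_torusDist_le_le (d : ℕ) {ε : ℝ} (hε : 0 < ε) (y : Torus d) :
    volume {x | torusDist y x ≤ ε} ≤ ENNReal.ofReal ((2 * ε) ^ d) := by
  calc volume {x | torusDist y x ≤ ε}
      ≤ volume (Set.univ.pi fun i => Metric.closedBall (y i) ε) := by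
        refine measure_mono fun x hx i _ => ?_
        rw [Metric.mem_closedBall, dist_comm]
        exact (dist_le_torusDist _ _ i).trans hx
    _ ≤ ∏ _i : Fin d, ENNReal.ofReal (2 * ε) := by
        rw [volume_pi_pi]
        refine Finset.prod_le_prod' fun i _ => ?_
        rw [AddCircle.volume_closedBall]
        exact ENNReal.ofReal_le_ofReal (min_le_right _ _)
    _ = _ := by
        rw [Finset.prod_const, Finset.card_univ, Fintype.card_fin,
          ENNReal.ofReal_pow (by positivity)]

lemma lintegral_ofReal_mu_mul_maxwellian (d : ℕ) {ε : ℝ} (hε : 0 < ε) :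
    ∫⁻ v, ENNReal.ofReal (mu d ε * maxwellian d v) = ENNReal.ofReal (mu d ε) := by
  rw [← ofReal_integral_eq_lintegral_ofReal ((integrable_maxwellian d).const_mul _)
    (ae_of_all _ fun v => mul_nonneg (mu_pos d hε).le (maxwellian_nonneg d v)), integral_const_mul,
    integral_maxwellian, mul_one]

lemma intensity_overlap_le (d : ℕ) {ε : ℝ} (hε : 0 < ε) (y : Phase d) :
    (intensity d ε).real {x | ¬ Apart d ε y x} ≤ 2 ^ d * ε := by
  refine ENNReal.toReal_le_of_le_ofReal (by positivity) ?_
  have hcont : Continuous fun x => torusDist y.1 x := by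
    unfold torusDist
    fun_prop
  have hB : MeasurableSet {x | torusDist y.1 x ≤ ε} :=
    measurableSet_le hcont.measurable measurable_const
  have hset : {x | ¬ Apart d ε y x} = {x | torusDist y.1 x ≤ ε} ×ˢ Set.univ := by
    ext x
    simp [Apart]
  have hres : (volume : Measure (Phase d)).restrict ({x | torusDist y.1 x ≤ ε} ×ˢ Set.univ) =
      (volume.restrict {x | torusDist y.1 x ≤ ε}).prod volume := by
    have h := Measure.prod_restrict (μ := (volume : Measure (Torus d)))
      (ν := (volume : Measure (EuclideanSpace ℝ (Fin d)))) {x | torusDist y.1 x ≤ ε} Set.univ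
    rw [Measure.restrict_univ] at h
    exact h.symm
  rw [hset, intensity, withDensity_apply _ (hB.prod MeasurableSet.univ), hres,
    lintegral_prod _ (measurable_mu_mul_maxwellian d ε).ennreal_ofReal.aemeasurable]
  simp only [lintegral_ofReal_mu_mul_maxwellian d hε, lintegral_const, Measure.restrict_apply_univ]
  calc _ ≤ ENNReal.ofReal (mu d ε) * ENNReal.ofReal ((2 * ε) ^ d) := by
        gcongr
        exact volume_torusDist_le_le d hε y.1
    _ = _ := by
      rw [← ENNReal.ofReal_mul (mu_pos d hε).le, mul_pow, mul_left_comm, mu_mul_pow d hε]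

lemma prod_mu_mul_maxwellian_mul_weight (d : ℕ) (ε : ℝ) {n : ℕ} (Z : Fin n → Phase d) :
    (∏ i, mu d ε * maxwellian d (Z i).2) * weight (Apart d ε) (fun _ => 1) ⟨n, Z⟩ =
      mu d ε ^ n * hsWeight d ε Z := by
  have h : compat (Apart d ε) ⟨n, Z⟩ = if HardCore d ε Z then 1 else 0 := by
    unfold compat HardCore Apart
    congr
  simp only [weight, h, hsWeight, Finset.prod_mul_distrib, Finset.prod_const, Finset.card_univ,
    Fintype.card_fin, one_pow]
  ring

lemma pi_intensity (d : ℕ) {ε : ℝ} (hε : 0 < ε) (n : ℕ) :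
    Measure.pi (fun _ : Fin n => intensity d ε) = (volume : Measure (Fin n → Phase d)).withDensity
      fun Z => ENNReal.ofReal (∏ i, mu d ε * maxwellian d (Z i).2) :=
  pi_withDensity_ofReal volume
    (fun z => mul_nonneg (mu_pos d hε).le (maxwellian_nonneg d z.2))
    (integrable_mu_mul_maxwellian d ε)

lemma measurable_prod_mu_mul_maxwellian (d : ℕ) (ε : ℝ) (n : ℕ) :
    Measurable fun Z : Fin n → Phase d => ∏ i, mu d ε * maxwellian d (Z i).2 :=
  Finset.measurable_fun_prod _ fun i _ =>
    (measurable_mu_mul_maxwellian d ε).comp (measurable_pi_apply i)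

lemma prod_mu_mul_maxwellian_nonneg (d : ℕ) {ε : ℝ} (hε : 0 < ε) {n : ℕ} (Z : Fin n → Phase d) :
    0 ≤ ∏ i, mu d ε * maxwellian d (Z i).2 :=
  Finset.prod_nonneg fun _ _ => mul_nonneg (mu_pos d hε).le (maxwellian_nonneg d _)

lemma integral_pi_intensity (d : ℕ) {ε : ℝ} (hε : 0 < ε) {n : ℕ} (F : (Fin n → Phase d) → ℝ) :
    1 / n.factorial * ∫ Z, weight (Apart d ε) (fun _ => 1) ⟨n, Z⟩ * F Z
        ∂(Measure.pi fun _ : Fin n => intensity d ε) =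
      mu d ε ^ n / n.factorial * ∫ Z, hsWeight d ε Z * F Z := by
  rw [pi_intensity d hε, integral_withDensity_eq_integral_toReal_smul
    (measurable_prod_mu_mul_maxwellian d ε n).ennreal_ofReal (ae_of_all _ fun _ => by simp)]
  simp only [ENNReal.toReal_ofReal (prod_mu_mul_maxwellian_nonneg d hε _), smul_eq_mul, ← mul_assoc,
    prod_mu_mul_maxwellian_mul_weight]
  simp only [mul_assoc, integral_const_mul]
  ring

lemma lintegral_pi_intensity (d : ℕ) {ε : ℝ} (hε : 0 < ε) {n : ℕ} {F : (Fin n → Phase d) → ℝ}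
    (hF : Measurable F) :
    ENNReal.ofReal (1 / n.factorial) * ∫⁻ Z,
        ENNReal.ofReal (weight (Apart d ε) (fun _ => 1) ⟨n, Z⟩ * F Z)
        ∂(Measure.pi fun _ : Fin n => intensity d ε) =
      ENNReal.ofReal (mu d ε ^ n / n.factorial) * ∫⁻ Z, ENNReal.ofReal (hsWeight d ε Z * F Z) := by
  have hW := (measurable_weight (measurableSet_apart d ε) (measurable_const (a := (1 : ℝ)))).comp
    (measurable_mk n)
  have hWF : Measurable fun Z =>
      ENNReal.ofReal (weight (Apart d ε) (fun _ => 1) ⟨n, Z⟩ * F Z) := (hW.mul hF).ennreal_ofReal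
  have hμ := mu_pos d hε
  rw [pi_intensity d hε, lintegral_withDensity_eq_lintegral_mul _
    (measurable_prod_mu_mul_maxwellian d ε n).ennreal_ofReal hWF]
  simp only [Pi.mul_apply, ← ENNReal.ofReal_mul (prod_mu_mul_maxwellian_nonneg d hε _), ← mul_assoc,
    prod_mu_mul_maxwellian_mul_weight]
  simp only [mul_assoc, ENNReal.ofReal_mul (pow_nonneg hμ.le n)]
  rw [lintegral_const_mul' _ _ ENNReal.ofReal_ne_top, ← mul_assoc,
    ← ENNReal.ofReal_mul (by positivity)]
  congr 2
  ring

lemma hasSum_mul_integral_hsWeight_mul (d : ℕ) {ε : ℝ} (hε : 0 < ε) {F : Config (Phase d) → ℝ}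
    (hF : Integrable (fun ω => weight (Apart d ε) (fun _ => 1) ω * F ω)
      (poisson (intensity d ε))) :
    HasSum (fun n : ℕ => mu d ε ^ n / n.factorial *
      ∫ Z : Fin n → Phase d, hsWeight d ε Z * F ⟨n, Z⟩)
      (∫ ω, weight (Apart d ε) (fun _ => 1) ω * F ω ∂poisson (intensity d ε)) := by
  simpa only [integral_pi_intensity d hε] using hasSum_integral_poisson (intensity d ε) hF

lemma partitionFn_eq (d : ℕ) {ε : ℝ} (hε : 0 < ε) :
    partitionFn d ε = partition (intensity d ε) (Apart d ε) fun _ => 1 := by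
  have h := hasSum_mul_integral_hsWeight_mul d hε (F := fun _ => 1) (by
    simpa using integrable_weight (measurableSet_apart d ε) (intensity d ε) isActivity_one)
  simp only [mul_one] at h
  exact h.tsum_eq

lemma memLp_intensity (d : ℕ) {ε : ℝ} (hε : 0 < ε) {h : Phase d → ℝ} (hh : Measurable h)
    (hi : Integrable fun z : Phase d => h z ^ 2 * maxwellian d z.2) :
    MemLp h 2 (intensity d ε) := by
  rw [memLp_two_iff_integrable_sq hh.aestronglyMeasurable, intensity,
    integrable_withDensity_iff_integrable_smul'
      (measurable_mu_mul_maxwellian d ε).ennreal_ofReal (ae_of_all _ fun _ => by simp)]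
  refine (hi.const_mul (mu d ε)).congr (ae_of_all _ fun z => ?_)
  simp only [ENNReal.toReal_ofReal (mul_nonneg (mu_pos d hε).le (maxwellian_nonneg d z.2)),
    smul_eq_mul]
  ring

lemma integral_sq_intensity (d : ℕ) {ε : ℝ} (hε : 0 < ε) (h : Phase d → ℝ) :
    ∫ z, h z ^ 2 ∂intensity d ε = mu d ε * ∫ z : Phase d, h z ^ 2 * maxwellian d z.2 := by
  rw [intensity, integral_withDensity_eq_integral_toReal_smul
      (measurable_mu_mul_maxwellian d ε).ennreal_ofReal (ae_of_all _ fun _ => by simp),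
    ← integral_const_mul]
  refine integral_congr_ae (ae_of_all _ fun z => ?_)
  dsimp only
  rw [ENNReal.toReal_ofReal (mul_nonneg (mu_pos d hε).le (maxwellian_nonneg d z.2)), smul_eq_mul]
  ring

lemma hasSum_empAvg (d : ℕ) {ε : ℝ} (hε : 0 < ε) {h : Phase d → ℝ} (hh : Measurable h)
    (hi : Integrable fun z : Phase d => h z ^ 2 * maxwellian d z.2) :
    HasSum (fun n : ℕ => mu d ε ^ n / n.factorial *
      ∫ Z : Fin n → Phase d, hsWeight d ε Z * empAvg d ε h Z)
      ((mu d ε)⁻¹ * moment (intensity d ε) (Apart d ε) (fun _ => 1) 0 h) := by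
  have hI := (integrable_moment (measurableSet_apart d ε) (intensity d ε) isActivity_one 0 hh
    ((memLp_intensity d hε hh hi).integrable (by norm_num))).const_mul (mu d ε)⁻¹
  simp only [zero_add, mul_left_comm (mu d ε)⁻¹] at hI
  have hS := hasSum_mul_integral_hsWeight_mul d hε hI
  simp only [mul_left_comm _ (mu d ε)⁻¹, integral_const_mul] at hS
  simp only [moment, empAvg, zero_add, mul_left_comm _ (mu d ε)⁻¹, integral_const_mul]
  exact hS

lemma Eexp_empAvg (d : ℕ) {ε : ℝ} (hε : 0 < ε) {h : Phase d → ℝ} (hh : Measurable h)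
    (hi : Integrable fun z : Phase d => h z ^ 2 * maxwellian d z.2) :
    Eexp d ε (fun _ Z => empAvg d ε h Z) =
      (mu d ε)⁻¹ * mean (intensity d ε) (Apart d ε) (fun _ => 1) h := by
  rw [Eexp, (hasSum_empAvg d hε hh hi).tsum_eq, partitionFn_eq d hε, mean]
  ring

lemma fluct_sq (d : ℕ) {ε : ℝ} (hε : 0 < ε) {h : Phase d → ℝ} (hh : Measurable h)
    (hi : Integrable fun z : Phase d => h z ^ 2 * maxwellian d z.2) {n : ℕ} (Z : Fin n → Phase d) :
    fluct d ε h n Z ^ 2 = (mu d ε)⁻¹ *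
      (pointSum h ⟨n, Z⟩ - mean (intensity d ε) (Apart d ε) (fun _ => 1) h) ^ 2 := by
  have hμ := mu_pos d hε
  rw [fluct, Eexp_empAvg d hε hh hi, empAvg, mul_pow, Real.sq_sqrt hμ.le, pointSum]
  field_simp

lemma lintegral_fluct_sq_div_le (d : ℕ) {ε : ℝ} (hε : 0 < ε) (hε' : ε < 1 / 2 ^ (d + 1))
    {h : Phase d → ℝ} (hh : Measurable h)
    (hi : Integrable fun z : Phase d => h z ^ 2 * maxwellian d z.2) :
    (∑' n : ℕ, ENNReal.ofReal (mu d ε ^ n / n.factorial) *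
        ∫⁻ Z : Fin n → Phase d, ENNReal.ofReal (hsWeight d ε Z * fluct d ε h n Z ^ 2)) /
        ENNReal.ofReal (partitionFn d ε) ≤
      ENNReal.ofReal (2 * ∫ z : Phase d, h z ^ 2 * maxwellian d z.2) := by
  have hμ := mu_pos d hε
  have hrm := measurableSet_apart d ε
  have hsmall : ∀ y, (intensity d ε).real {x | ¬ Apart d ε y x} ≤ 1 / 2 := by
    intro y
    refine (intensity_overlap_le d hε y).trans ?_
    rw [lt_div_iff₀ (by positivity), pow_succ] at hε'
    linarith
  have hZ : 1 ≤ partitionFn d ε := by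
    rw [partitionFn_eq d hε]
    exact one_le_partition hrm _ isActivity_one
  obtain ⟨hVi, hV⟩ := integral_weight_mul_sub_mean_sq_le hrm (intensity d ε) (apart_comm d ε)
    (by norm_num) hsmall hh (memLp_intensity d hε hh hi)
  rw [← partitionFn_eq d hε, integral_sq_intensity d hε] at hV
  set m := mean (intensity d ε) (Apart d ε) (fun _ => 1) h with hm
  have hVi' := hVi.const_mul (mu d ε)⁻¹
  have hFm : Measurable fun ω : Config (Phase d) => (mu d ε)⁻¹ * (pointSum h ω - m) ^ 2 :=
    (((measurable_pointSum hh).sub_const m).pow_const 2).const_mul _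
  have hLm := ((measurable_weight hrm (measurable_const (a := (1 : ℝ)))).mul hFm).ennreal_ofReal
  have hsum := lintegral_poisson (intensity d ε) hLm
  have hsec := fun n : ℕ => lintegral_pi_intensity d hε (hFm.comp (measurable_mk n))
  simp only [Function.comp_apply] at hsec
  simp only [Pi.mul_apply, hsec] at hsum
  simp only [fluct_sq d hε hh hi, ← hm]
  rw [← hsum]
  simp only [mul_left_comm _ (mu d ε)⁻¹]
  rw [← ofReal_integral_eq_lintegral_ofReal hVi' (ae_of_all _ fun ω => mul_nonneg
      (inv_nonneg.2 hμ.le) (mul_nonneg (weight_nonneg isActivity_one ω) (sq_nonneg _))),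
    ← ENNReal.ofReal_div_of_pos (by linarith), integral_const_mul]
  refine ENNReal.ofReal_le_ofReal ?_
  rw [div_le_iff₀ (by linarith), inv_mul_le_iff₀ hμ]
  refine hV.trans (le_of_eq ?_)
  norm_num
  ring

end HardSpheres

/-- The a priori second-moment bound (1.11) on the equilibrium fluctuation field:
`E_ε(ζ(h)²) ≤ C ‖h‖²_{L²_M}`, with `C` and `ε₀` depending only on `d`; the
expectations converge absolutely (the expectation of the nonnegative `ζ(h)²` is
expressed in the extended sense, so the bound also asserts its finiteness). -/
theorem stmt_10 (d : ℕ) (hd : 2 ≤ d) :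
    ∃ C : ℝ, 0 < C ∧ ∃ ε₀ ∈ Set.Ioo (0 : ℝ) 1,
      ∀ ε : ℝ, 0 < ε → ε < ε₀ →
      ∀ h : Phase d → ℝ, Measurable h →
        Integrable (fun z : Phase d => h z ^ 2 * maxwellian d z.2) →
        Summable (fun n : ℕ =>
            |mu d ε ^ n / n.factorial *
              ∫ Z : Fin n → Phase d, hsWeight d ε Z * empAvg d ε h Z|) ∧
        (∑' n : ℕ,
            ENNReal.ofReal (mu d ε ^ n / n.factorial) *
              ∫⁻ Z : Fin n → Phase d,
                ENNReal.ofReal (hsWeight d ε Z * fluct d ε h n Z ^ 2)) /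
          ENNReal.ofReal (partitionFn d ε)
          ≤ ENNReal.ofReal (C * ∫ z : Phase d, h z ^ 2 * maxwellian d z.2) := by
  refine ⟨2, two_pos, 1 / 2 ^ (d + 1), ⟨by positivity, ?_⟩, fun ε hε hε' h hh hi => ?_⟩
  · rw [div_lt_one (by positivity)]
    exact one_lt_pow₀ one_lt_two (Nat.succ_ne_zero d)
  refine ⟨(hasSum_empAvg d hε hh hi).summable.abs, lintegral_fluct_sq_div_le d hε hε' hh hi⟩
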